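/- arXiv:2203.01410 — 2 statements merged into one kernel-verified Lean document; each statement's English description precedes it below -/
import Mathlib

section
/- Let A be the 6×6 real matrix with rows (0,1,0,0,0,0), (1.000002542612694, 0, 0, 2, 0, 0), (0,0,0,1,0,0), (0, -0.000294117647059, 0, 0, 0, 0), (0,0,0,0,0,1), (0,0,0,0,-0.00000127311747,0), and let B be the 6×1 column vector (0,1,0,0,0,0)ᵀ (a single thruster in the radial r-direction). Then the Kalman controllability matrix Q = [B, AB, A²B, A³B, A⁴B, A⁵B], viewed as a 6×6 real matrix, has rank 3; in particular its rank is strictly less than 6. -/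
/-- Linearized satellite dynamics matrix under the `J₂` zonal harmonic. -/
def A : Matrix (Fin 6) (Fin 6) ℝ :=
  !![0, 1, 0, 0, 0, 0;
     1.000002542612694, 0, 0, 2, 0, 0;
     0, 0, 0, 1, 0, 0;
     0, -0.000294117647059, 0, 0, 0, 0;
     0, 0, 0, 0, 0, 1;
     0, 0, 0, 0, -0.00000127311747, 0]

/-- Input matrix: thruster columns. -/
def B : Matrix (Fin 6) (Fin 1) ℝ :=
  !![0;
     1;
     0;
     0;
     0;
     0]

/-- Kalman controllability matrix `Q = [B, AB, A²B, A³B, A⁴B, A⁵B]`,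
viewed as a `6 × 6` real matrix with columns indexed by `Fin 6 × Fin 1`. -/
def Q : Matrix (Fin 6) (Fin 6 × Fin 1) ℝ :=
  Matrix.of fun i p => (A ^ (p.1 : ℕ) * B) i p.2

/-- The eigenvalue of `A ^ 2` on `A * B`. -/
noncomputable def radialEigenvalue : ℝ := 1.000002542612694 - 2 * 0.000294117647059

lemma A_mul_planar (x y z w : ℝ) :
    A * !![x; y; z; w; 0; 0] =
      !![y; 1.000002542612694 * x + 2 * w; w; -0.000294117647059 * y; 0; 0] := by
  ext i j
  fin_cases i <;> fin_cases j <;> simp [A, Matrix.mul_apply, Fin.sum_univ_succ]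

lemma A_mul_B : A * B = !![1; 0; 0; -0.000294117647059; 0; 0] := by
  rw [B, A_mul_planar]
  norm_num

lemma A_sq_mul_B :
    A ^ 2 * B = !![0; radialEigenvalue; -0.000294117647059; 0; 0; 0] := by
  rw [pow_two, Matrix.mul_assoc, A_mul_B, A_mul_planar]
  norm_num [radialEigenvalue]

lemma A_pow_three_mul_B : A ^ 3 * B = radialEigenvalue • (A * B) := by
  rw [pow_succ', Matrix.mul_assoc, A_sq_mul_B, A_mul_B, A_mul_planar]
  simp [Matrix.smul_of, mul_comm]

lemma A_pow_add_three_mul_B (n : ℕ) :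
    A ^ (n + 3) * B = radialEigenvalue • (A ^ (n + 1) * B) := by
  rw [pow_add, Matrix.mul_assoc, A_pow_three_mul_B, Matrix.mul_smul, ← Matrix.mul_assoc,
    ← pow_succ]

/-- The first three columns of `Q`. -/
noncomputable def leadingColumns : Matrix (Fin 6) (Fin 3) ℝ :=
  Q.submatrix id fun j => (Fin.castLE (by norm_num) j, 0)

/-- The coordinates of the columns of `Q` in terms of its first three columns. -/
noncomputable def columnCoordinates : Matrix (Fin 3) (Fin 6 × Fin 1) ℝ :=
  Matrix.of fun i p =>
    !![1, 0, 0, 0, 0, 0;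
       0, 1, 0, radialEigenvalue, 0, radialEigenvalue ^ 2;
       0, 0, 1, 0, radialEigenvalue, 0] i p.1

lemma Q_eq_leadingColumns_mul : Q = leadingColumns * columnCoordinates := by
  have h3 := A_pow_add_three_mul_B 0
  have h4 := A_pow_add_three_mul_B 1
  have h5 := A_pow_add_three_mul_B 2
  norm_num at h3 h4 h5
  rw [h3] at h5
  ext i ⟨j, l⟩
  fin_cases l
  rw [Matrix.mul_apply, Fin.sum_univ_three]
  fin_cases j <;> simp [Q, leadingColumns, columnCoordinates, h3, h4, h5] <;> ring

lemma rank_Q_le : Q.rank ≤ 3 := by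
  rw [Q_eq_leadingColumns_mul]
  exact (Matrix.rank_mul_le_left _ _).trans (Matrix.rank_le_width _)

lemma leadingColumns_submatrix :
    leadingColumns.submatrix ![1, 0, 2] id =
      !![1, 0, radialEigenvalue; 0, 1, 0; 0, 0, -0.000294117647059] := by
  ext i j
  fin_cases i <;> fin_cases j <;>
    simp [leadingColumns, Q, A_mul_B, A_sq_mul_B] <;> simp [B]

lemma three_le_rank_Q : 3 ≤ Q.rank := by
  have h : (leadingColumns.submatrix ![1, 0, 2] id).rank = 3 := by
    rw [Matrix.rank_of_isUnit, Fintype.card_fin]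
    rw [Matrix.isUnit_iff_isUnit_det, leadingColumns_submatrix, Matrix.det_fin_three]
    simp
    norm_num
  rw [← h, leadingColumns, Matrix.submatrix_submatrix]
  exact Matrix.rank_submatrix_le _ _ _

theorem kalman_rank_r : Q.rank = 3 ∧ Q.rank < 6 := by
  have h : Q.rank = 3 := le_antisymm rank_Q_le three_le_rank_Q
  exact ⟨h, by omega⟩
end

section
/- Let A be the 6×6 real matrix with rows (0,1,0,0,0,0), (1.000002542612694, 0, 0, 2, 0, 0), (0,0,0,1,0,0), (0, -0.000294117647059, 0, 0, 0, 0), (0,0,0,0,0,1), (0,0,0,0,-0.00000127311747,0), and let B be the 6×1 column vector (0,1,0,0,0,0)ᵀ (a single thruster in the radial r-direction). Then the linear control system ẋ(t) = A x(t) + B u(t) is not controllable: for every t₀ < t₁ in ℝ there exists a target state x₁ ∈ ℝ⁶ such that for every continuous control u : ℝ → ℝ and every differentiable trajectory x : ℝ → ℝ⁶ satisfying x′(t) = A x(t) + B u(t) for all t and x(t₀) = 0, one has x(t₁) ≠ x₁. -/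
/-- Under radial thrust, the quantity `x₃ + c x₀` is conserved along every trajectory. -/
theorem hasDerivAt_radial_invariant {u : ℝ → ℝ} {x : ℝ → Fin 6 → ℝ} {t : ℝ}
    (hx : HasDerivAt x (A.mulVec (x t) + B.mulVec (fun _ => u t)) t) :
    HasDerivAt (fun s => x s 3 + 0.000294117647059 * x s 0) 0 t := by
  have h := hasDerivAt_pi.1 hx
  refine ((h 3).add ((h 0).const_mul (0.000294117647059 : ℝ))).congr_deriv ?_
  simp [A, B, dotProduct, Fin.sum_univ_six]

theorem not_controllable_r :
    ∀ t₀ t₁ : ℝ, t₀ < t₁ →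
      ∃ x₁ : Fin 6 → ℝ, ∀ u : ℝ → ℝ, Continuous u →
        ∀ x : ℝ → Fin 6 → ℝ,
          (∀ t : ℝ, HasDerivAt x (A.mulVec (x t) + B.mulVec (fun _ => u t)) t) →
          x t₀ = 0 → x t₁ ≠ x₁ := by
  intro t₀ t₁ _
  refine ⟨Pi.single 3 1, fun u _ x hx h₀ h₁ => ?_⟩
  have h := is_const_of_deriv_eq_zero
    (fun t => (hasDerivAt_radial_invariant (hx t)).differentiableAt)
    (fun t => (hasDerivAt_radial_invariant (hx t)).deriv) t₁ t₀
  simp [h₀, h₁] at h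
end
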